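/- arXiv:2509.06090 — 4 statements merged into one kernel-verified Lean document; each statement's English description precedes it below -/
import Mathlib

section
/- Zero is not an eigenvalue of the half-line operator H: if v ∈ C²((0,∞),ℝ) satisfies H v = 0 on (0,∞), is square-integrable with respect to Lebesgue measure dr on (0,∞), and satisfies the asymptotics v(r) = O(r^{1/2}), v'(r) = O(r^{−1/2}) as r → 0⁺ and v(r) = O(e^{−(√5/2)r}), v'(r) = O(e^{−(√5/2)r}) as r → ∞, then v ≡ 0. -/
/- Zero is not an eigenvalue of the half-line operator H. -/

open MeasureTheory Set Filter Asymptotics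
open scoped Topology

noncomputable section

/-- The half-line operator `H v = −v'' − v/(4 sinh²r) + (5/4)v + (Q²−1)v`,
the conjugation `sinh^{1/2}·𝓗·sinh^{-1/2}` of `𝓗 = −Δ_{ℍ²} + Q²`. -/
def Hop (Q : ℝ → ℝ) (v : ℝ → ℝ) (r : ℝ) : ℝ :=
  -deriv (deriv v) r - v r / (4 * Real.sinh r ^ 2) + (5/4) * v r
    + (Q r ^ 2 - 1) * v r

/-- The radial flux `sinh r · u u'` of `u = sinh^{-1/2} v`, written in terms of `v`. -/
def radialFlux (v : ℝ → ℝ) (r : ℝ) : ℝ :=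
  v r * deriv v r - v r ^ 2 * Real.cosh r / (2 * Real.sinh r)

theorem hasDerivAt_sq_div_sinh {v : ℝ → ℝ} {r : ℝ} (hr : 0 < r)
    (hv : DifferentiableAt ℝ v r) :
    HasDerivAt (fun x => v x ^ 2 / Real.sinh x) (2 * radialFlux v r / Real.sinh r) r := by
  have hs : Real.sinh r ≠ 0 := (Real.sinh_pos_iff.2 hr).ne'
  refine ((hv.hasDerivAt.fun_pow 2).fun_div (Real.hasDerivAt_sinh r) hs).congr_deriv ?_
  unfold radialFlux
  field_simp
  ring

theorem hasDerivAt_radialFlux {Q v : ℝ → ℝ} {r : ℝ} (hr : 0 < r)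
    (hv : DifferentiableAt ℝ v r) (hv' : DifferentiableAt ℝ (deriv v) r)
    (h : Hop Q v r = 0) :
    HasDerivAt (radialFlux v)
      ((deriv v r - v r * Real.cosh r / (2 * Real.sinh r)) ^ 2 + Q r ^ 2 * v r ^ 2) r := by
  have hs : Real.sinh r ≠ 0 := (Real.sinh_pos_iff.2 hr).ne'
  have hvd := hv.hasDerivAt
  have hd := (hvd.fun_mul hv'.hasDerivAt).fun_sub
    (((hvd.fun_pow 2).fun_mul (Real.hasDerivAt_cosh r)).fun_div
      ((Real.hasDerivAt_sinh r).const_mul 2) (mul_ne_zero two_ne_zero hs))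
  refine HasDerivAt.congr_deriv hd ?_
  have h2 : deriv (deriv v) r
      = -v r / (4 * Real.sinh r ^ 2) + (5/4) * v r + (Q r ^ 2 - 1) * v r := by
    unfold Hop at h
    rw [neg_div]
    linarith
  rw [h2]
  have hc := Real.cosh_sq r
  field_simp
  ring_nf
  rw [hc]
  ring

theorem tendsto_log_sinh_nhdsGT_zero :
    Tendsto (fun r => Real.log (Real.sinh r)) (𝓝[>] 0) atBot := by
  refine Real.tendsto_log_nhdsGT_zero.comp (tendsto_nhdsWithin_iff.2 ⟨?_, ?_⟩)
  · simpa using (Real.continuous_sinh.tendsto 0).mono_left nhdsWithin_le_nhds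
  · filter_upwards [self_mem_nhdsWithin] with r hr
    exact Real.sinh_pos_iff.2 hr

theorem radialFlux_nonpos {v : ℝ → ℝ} (hv : ∀ r, 0 < r → DifferentiableAt ℝ v r)
    (hmono : MonotoneOn (radialFlux v) (Ioi 0)) (hvinf : Tendsto v atTop (𝓝 0))
    {r : ℝ} (hr : 0 < r) : radialFlux v r ≤ 0 := by
  by_contra! hF
  have hG : MonotoneOn (fun x => v x ^ 2 / Real.sinh x) (Ici r) := by
    refine monotoneOn_of_hasDerivWithinAt_nonneg (convex_Ici r)
      (fun x hx => (hasDerivAt_sq_div_sinh (hr.trans_le hx)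
        (hv x (hr.trans_le hx))).continuousAt.continuousWithinAt)
      (f' := fun x => 2 * radialFlux v x / Real.sinh x) ?_ ?_
    · intro x hx
      rw [interior_Ici] at hx
      exact (hasDerivAt_sq_div_sinh (hr.trans hx) (hv x (hr.trans hx))).hasDerivWithinAt
    · intro x hx
      rw [interior_Ici] at hx
      have hx0 : 0 < x := hr.trans hx
      have := Real.sinh_pos_iff.2 hx0
      have := hF.le.trans (hmono hr hx0 (le_of_lt hx))
      positivity
  have hlim : Tendsto (fun x => v x ^ 2) atTop (𝓝 0) := by
    simpa using hvinf.pow 2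
  have hle : v r ^ 2 / Real.sinh r ≤ 0 := by
    refine ge_of_tendsto hlim ?_
    filter_upwards [eventually_ge_atTop r, eventually_ge_atTop 1] with x hx hx1
    have hs : 1 ≤ Real.sinh x := hx1.trans (Real.self_le_sinh_iff.2 (by linarith))
    exact (hG self_mem_Ici hx hx).trans (div_le_self (sq_nonneg _) hs)
  have hv0 : v r = 0 := by
    have hs := Real.sinh_pos_iff.2 hr
    rw [div_le_iff₀ hs, zero_mul] at hle
    exact pow_eq_zero_iff two_ne_zero |>.1 (le_antisymm hle (sq_nonneg _))
  simp [radialFlux, hv0] at hF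

theorem radialFlux_nonneg {v : ℝ → ℝ} (hv : ∀ r, 0 < r → DifferentiableAt ℝ v r)
    (hmono : MonotoneOn (radialFlux v) (Ioi 0))
    (hv0 : v =O[𝓝[>] (0:ℝ)] fun r => Real.sqrt r)
    {r : ℝ} (hr : 0 < r) : 0 ≤ radialFlux v r := by
  by_contra! hF
  set k := -radialFlux v r / Real.cosh r with hk
  have hcr : 0 < Real.cosh r := Real.cosh_pos r
  have hk0 : 0 < k := div_pos (neg_pos.2 hF) hcr
  have hkc : k * Real.cosh r = -radialFlux v r := div_mul_cancel₀ _ hcr.ne'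
  have hd : ∀ x, 0 < x → HasDerivAt
      (fun x => v x ^ 2 / Real.sinh x + 2 * k * Real.log (Real.sinh x))
      (2 * radialFlux v x / Real.sinh x + 2 * k * (Real.cosh x / Real.sinh x)) x :=
    fun x hx => (hasDerivAt_sq_div_sinh hx (hv x hx)).add
      (((Real.hasDerivAt_sinh x).log (Real.sinh_pos_iff.2 hx).ne').const_mul (2 * k))
  have hanti : AntitoneOn (fun x => v x ^ 2 / Real.sinh x + 2 * k * Real.log (Real.sinh x))
      (Ioc 0 r) := by
    refine antitoneOn_of_hasDerivWithinAt_nonpos (convex_Ioc 0 r)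
      (fun x hx => (hd x hx.1).continuousAt.continuousWithinAt)
      (fun x hx => (hd x (interior_subset hx).1).hasDerivWithinAt) ?_
    intro x hx
    obtain ⟨hx0, hxr⟩ := interior_subset hx
    have hs := Real.sinh_pos_iff.2 hx0
    have h1 : radialFlux v x ≤ radialFlux v r := hmono hx0 hr hxr
    have h2 : Real.cosh x ≤ Real.cosh r :=
      Real.cosh_le_cosh.2 (by rwa [abs_of_pos hx0, abs_of_pos hr])
    have h3 := mul_le_mul_of_nonneg_left h2 hk0.le
    rw [← mul_div_assoc, ← add_div]
    exact div_nonpos_of_nonpos_of_nonneg (by linarith) hs.le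
  obtain ⟨C, hC⟩ := hv0.bound
  have hlog := tendsto_log_sinh_nhdsGT_zero.const_mul_atBot (mul_pos two_pos hk0)
  obtain ⟨x, hxC, hxlog, hx0, hxr⟩ := (hC.and ((hlog.eventually_lt_atBot
    (v r ^ 2 / Real.sinh r + 2 * k * Real.log (Real.sinh r) - C ^ 2)).and
    (Ioc_mem_nhdsGT hr))).exists
  have hs := Real.sinh_pos_iff.2 hx0
  have hGx : v x ^ 2 / Real.sinh x ≤ C ^ 2 := by
    rw [div_le_iff₀ hs]
    calc v x ^ 2 = ‖v x‖ ^ 2 := by simp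
      _ ≤ (C * ‖Real.sqrt x‖) ^ 2 := by gcongr
      _ = C ^ 2 * x := by
        rw [mul_pow, Real.norm_eq_abs, sq_abs, Real.sq_sqrt hx0.le]
      _ ≤ C ^ 2 * Real.sinh x := by
        gcongr
        exact Real.self_le_sinh_iff.2 hx0.le
  have := hanti ⟨hx0, hxr⟩ ⟨hr, le_rfl⟩ hxr
  simp only at this
  linarith

/-- **Zero is not an eigenvalue of `H`:** any solution of `Hv = 0` on `(0,∞)` which is
square-integrable (w.r.t. Lebesgue measure) and has the stated asymptotics at `0⁺` and
`∞` vanishes identically. -/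
theorem H_no_zero_eigenvalue
    (m : ℕ) (hm : 1 ≤ m) (Q A : ℝ → ℝ)
    (hQsmooth : ContDiffOn ℝ (⊤ : ℕ∞) Q (Set.Ioi 0))
    (hAsmooth : ContDiffOn ℝ (⊤ : ℕ∞) A (Set.Ioi 0))
    (hBog1 : ∀ r ∈ Set.Ioi (0:ℝ), deriv Q r + (A r - m) / Real.sinh r * Q r = 0)
    (hBog2 : ∀ r ∈ Set.Ioi (0:ℝ), deriv A r = Real.sinh r * (1 - Q r ^ 2) / 2)
    (hQpos : ∀ r ∈ Set.Ioi (0:ℝ), 0 < Q r)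
    (hQlt1 : ∀ r ∈ Set.Ioi (0:ℝ), Q r < 1)
    (hAnonneg : ∀ r ∈ Set.Ioi (0:ℝ), 0 ≤ A r)
    (hAltm : ∀ r ∈ Set.Ioi (0:ℝ), A r < m)
    (v : ℝ → ℝ)
    (hvC2 : ContDiffOn ℝ 2 v (Set.Ioi 0))
    (hveq : ∀ r ∈ Set.Ioi (0:ℝ), Hop Q v r = 0)
    (hvL2 : IntegrableOn (fun r => v r ^ 2) (Set.Ioi 0))
    (hv0 : v =O[𝓝[>] (0:ℝ)] fun r => Real.sqrt r)
    (hv0' : deriv v =O[𝓝[>] (0:ℝ)] fun r => (Real.sqrt r)⁻¹)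
    (hvinf : v =O[atTop] fun r => Real.exp (-(Real.sqrt 5 / 2) * r))
    (hvinf' : deriv v =O[atTop] fun r => Real.exp (-(Real.sqrt 5 / 2) * r)) :
    ∀ r ∈ Set.Ioi (0:ℝ), v r = 0 := by
  have hnhds : ∀ r : ℝ, 0 < r → Ioi (0:ℝ) ∈ 𝓝 r := fun r hr => Ioi_mem_nhds hr
  have hv : ∀ r, 0 < r → DifferentiableAt ℝ v r := fun r hr =>
    (hvC2.differentiableOn two_ne_zero).differentiableAt (hnhds r hr)
  have hv' : ∀ r, 0 < r → DifferentiableAt ℝ (deriv v) r := fun r hr =>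
    ((hvC2.deriv_of_isOpen (m := 1) isOpen_Ioi (by norm_num)).differentiableOn
      one_ne_zero).differentiableAt (hnhds r hr)
  have hd := fun r (hr : 0 < r) => hasDerivAt_radialFlux hr (hv r hr) (hv' r hr) (hveq r hr)
  have hmono : MonotoneOn (radialFlux v) (Ioi 0) := by
    refine monotoneOn_of_hasDerivWithinAt_nonneg (convex_Ioi 0)
      (fun x hx => (hd x hx).continuousAt.continuousWithinAt)
      (fun x hx => (hd x (interior_subset hx)).hasDerivWithinAt) ?_
    intro x _
    positivity
  have hvlim : Tendsto v atTop (𝓝 0) := by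
    refine hvinf.trans_tendsto (Real.tendsto_exp_atBot.comp ?_)
    exact tendsto_id.const_mul_atTop_of_neg (neg_lt_zero.2 (by positivity))
  have hzero : ∀ r, 0 < r → radialFlux v r = 0 := fun r hr =>
    le_antisymm (radialFlux_nonpos hv hmono hvlim hr) (radialFlux_nonneg hv hmono hv0 hr)
  intro r hr
  have hconst : radialFlux v =ᶠ[𝓝 r] fun _ => 0 := by
    filter_upwards [hnhds r hr] with x hx using hzero x hx
  have heq := (hd r hr).unique ((hasDerivAt_const r (0:ℝ)).congr_of_eventuallyEq hconst)
  have hQv : Q r ^ 2 * v r ^ 2 = 0 :=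
    ((add_eq_zero_iff_of_nonneg (by positivity) (by positivity)).1 heq).2
  simpa [(hQpos r hr).ne'] using hQv

end
end

section
/- Explicit fundamental system for the model operator H₀: for every r > 0, the functions ψ₁(r) = sinh^{1/2}(r) and ψ₂(r) = sinh^{1/2}(r)·log(tanh(r/2)) satisfy H₀ψ₁ = 0 and H₀ψ₂ = 0, where H₀ f := −f'' + (1/4)f − f/(4 sinh²(r)). -/
/- Explicit fundamental system for the model operator H₀. -/

open Set

noncomputable section

/-- The model operator `H₀ f = −f'' + (1/4)f − f/(4 sinh²r)`. -/
def H0op (f : ℝ → ℝ) (r : ℝ) : ℝ :=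
  -deriv (deriv f) r + (1/4) * f r - f r / (4 * Real.sinh r ^ 2)

theorem hasDerivAt_sqrt_sinh {r : ℝ} (hr : 0 < r) :
    HasDerivAt (fun s => Real.sqrt (Real.sinh s))
      (Real.cosh r / (2 * Real.sqrt (Real.sinh r))) r :=
  (Real.hasDerivAt_sinh r).sqrt (Real.sinh_pos_iff.2 hr).ne'

theorem hasDerivAt_log_tanh_half {r : ℝ} (hr : 0 < r) :
    HasDerivAt (fun s => Real.log (Real.tanh (s / 2))) (1 / Real.sinh r) r := by
  have hs : 0 < Real.sinh (r / 2) := Real.sinh_pos_iff.2 (by linarith)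
  have hc : 0 < Real.cosh (r / 2) := Real.cosh_pos _
  have hh : HasDerivAt (fun s : ℝ => s / 2) (1 / 2) r := (hasDerivAt_id r).div_const 2
  have key := (hh.sinh.div hh.cosh hc.ne').log (div_pos hs hc).ne'
  have hsinh : Real.sinh r = 2 * Real.sinh (r / 2) * Real.cosh (r / 2) := by
    rw [← Real.sinh_two_mul]; ring_nf
  simp only [Real.tanh_eq_sinh_div_cosh]
  refine key.congr_deriv ?_
  rw [hsinh]
  simp only [Pi.div_apply]
  field_simp
  linarith [Real.cosh_sq (r / 2)]

theorem hasDerivAt_deriv_sqrt_sinh {r : ℝ} (hr : 0 < r) :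
    HasDerivAt (fun s => Real.cosh s / (2 * Real.sqrt (Real.sinh s)))
      (Real.sqrt (Real.sinh r) / 4 - Real.sqrt (Real.sinh r) / (4 * Real.sinh r ^ 2)) r := by
  have hu : 0 < Real.sqrt (Real.sinh r) := Real.sqrt_pos.2 (Real.sinh_pos_iff.2 hr)
  have hsq : Real.sinh r = Real.sqrt (Real.sinh r) ^ 2 :=
    (Real.sq_sqrt (Real.sinh_pos_iff.2 hr).le).symm
  refine ((Real.hasDerivAt_cosh r).div ((hasDerivAt_sqrt_sinh hr).const_mul 2)
    (by positivity)).congr_deriv ?_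
  have hc := Real.cosh_sq r
  generalize Real.sqrt (Real.sinh r) = u at *
  rw [hsq] at hc ⊢
  field_simp
  rw [hc]
  ring

theorem H0op_eq_zero_of_hasDerivAt {f g : ℝ → ℝ} {r : ℝ} (hr : 0 < r)
    (hf : ∀ s, 0 < s → HasDerivAt f (g s) s)
    (hg : HasDerivAt g (f r / 4 - f r / (4 * Real.sinh r ^ 2)) r) : H0op f r = 0 := by
  have he : deriv f =ᶠ[nhds r] g := by
    filter_upwards [Ioi_mem_nhds hr] with s hs using (hf s hs).deriv
  rw [H0op, he.deriv_eq, hg.deriv]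
  ring

/-- **Explicit fundamental system for `H₀`:** `ψ₁ = sinh^{1/2}` and
`ψ₂ = sinh^{1/2}·log(tanh(r/2))` satisfy `H₀ψ₁ = H₀ψ₂ = 0` on `(0,∞)`. -/
theorem H0_fundamental_system :
    ∀ r ∈ Set.Ioi (0:ℝ),
      H0op (fun s => Real.sqrt (Real.sinh s)) r = 0 ∧
      H0op (fun s => Real.sqrt (Real.sinh s) * Real.log (Real.tanh (s / 2))) r = 0 := by
  intro r hr
  refine ⟨H0op_eq_zero_of_hasDerivAt hr (fun s hs => hasDerivAt_sqrt_sinh hs)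
    (hasDerivAt_deriv_sqrt_sinh hr), H0op_eq_zero_of_hasDerivAt hr
    (fun s hs => (hasDerivAt_sqrt_sinh hs).mul (hasDerivAt_log_tanh_half hs)) ?_⟩
  have hu : 0 < Real.sqrt (Real.sinh r) := Real.sqrt_pos.2 (Real.sinh_pos_iff.2 hr)
  have hsq : Real.sinh r = Real.sqrt (Real.sinh r) ^ 2 :=
    (Real.sq_sqrt (Real.sinh_pos_iff.2 hr).le).symm
  refine (((hasDerivAt_deriv_sqrt_sinh hr).mul (hasDerivAt_log_tanh_half hr)).add
    ((hasDerivAt_sqrt_sinh hr).mul ((hasDerivAt_const r (1 : ℝ)).div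
      (Real.hasDerivAt_sinh r) (Real.sinh_pos_iff.2 hr).ne'))).congr_deriv ?_
  simp only [Pi.div_apply]
  generalize Real.log (Real.tanh (r / 2)) = l
  generalize Real.sqrt (Real.sinh r) = u at *
  rw [hsq]
  field_simp
  ring

end
end

section
/- Equivariant factorization identity: let A ∈ C¹((0,∞),ℝ), let m ∈ ℤ, and define, for k ∈ ℤ, the operators D̃_{+,k}ψ := ψ' + ((A − k)/sinh r)ψ and D̃*_{+,k}ψ := −ψ' − coth(r)ψ + ((A − k + 1)/sinh r)ψ. Then for every ψ ∈ C²((0,∞),ℂ) and every r > 0: D̃*_{+,m+2}(D̃_{+,m+1}ψ)(r) = −ψ''(r) − coth(r)ψ'(r) − (A'(r)/sinh r)ψ(r) + ((A(r) − m − 1)/sinh r)²ψ(r). -/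
/- Equivariant factorization identity for the covariant Cauchy–Riemann operators. -/

open Set

noncomputable section

/-- Hyperbolic cotangent. -/
def hcoth (r : ℝ) : ℝ := Real.cosh r / Real.sinh r

/-- The equivariant covariant Cauchy–Riemann operator
`D̃_{+,k} ψ = ψ' + ((A − k)/sinh r)ψ`. -/
def Dp (A : ℝ → ℝ) (k : ℤ) (ψ : ℝ → ℂ) (r : ℝ) : ℂ :=
  deriv ψ r + (((A r - k) / Real.sinh r : ℝ) : ℂ) * ψ r

/-- Its formal adjoint `D̃*_{+,k} ψ = −ψ' − coth(r)ψ + ((A − k + 1)/sinh r)ψ`. -/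
def Dps (A : ℝ → ℝ) (k : ℤ) (ψ : ℝ → ℂ) (r : ℝ) : ℂ :=
  -deriv ψ r - ((hcoth r : ℝ) : ℂ) * ψ r + (((A r - k + 1) / Real.sinh r : ℝ) : ℂ) * ψ r

theorem hasDerivAt_sub_const_div_sinh {A : ℝ → ℝ} {a r : ℝ} (c : ℝ) (hA : HasDerivAt A a r)
    (hr : Real.sinh r ≠ 0) :
    HasDerivAt (fun s => (A s - c) / Real.sinh s)
      (a / Real.sinh r - hcoth r * ((A r - c) / Real.sinh r)) r := by
  refine ((hA.sub_const c).div (Real.hasDerivAt_sinh r) hr).congr_deriv ?_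
  unfold hcoth
  field_simp

/-- **Equivariant factorization identity:**
`D̃*_{+,m+2}(D̃_{+,m+1}ψ) = −ψ'' − coth(r)ψ' − (A'/sinh r)ψ + ((A−m−1)/sinh r)²ψ`. -/
theorem equivariant_factorization
    (A : ℝ → ℝ) (hA : ContDiffOn ℝ 1 A (Set.Ioi 0))
    (m : ℤ)
    (ψ : ℝ → ℂ) (hψ : ContDiffOn ℝ 2 ψ (Set.Ioi 0)) :
    ∀ r ∈ Set.Ioi (0:ℝ),
      Dps A (m + 2) (fun s => Dp A (m + 1) ψ s) r
        = -deriv (deriv ψ) r - ((hcoth r : ℝ) : ℂ) * deriv ψ r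
          - ((deriv A r / Real.sinh r : ℝ) : ℂ) * ψ r
          + (((A r - m - 1) / Real.sinh r : ℝ) : ℂ) ^ 2 * ψ r := by
  intro r hr
  have hmem : Set.Ioi (0 : ℝ) ∈ nhds r := Ioi_mem_nhds hr
  have hsinh : Real.sinh r ≠ 0 := (Real.sinh_pos_iff.mpr hr).ne'
  have hA' : HasDerivAt A (deriv A r) r :=
    ((hA.contDiffAt hmem).differentiableAt one_ne_zero).hasDerivAt
  have hψ' : HasDerivAt ψ (deriv ψ r) r :=
    ((hψ.contDiffAt hmem).differentiableAt two_ne_zero).hasDerivAt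
  have hψ'' : HasDerivAt (deriv ψ) (deriv (deriv ψ) r) r :=
    ((((contDiffOn_succ_iff_deriv_of_isOpen (n := 1) isOpen_Ioi).mp hψ).2.2.contDiffAt
      hmem).differentiableAt one_ne_zero).hasDerivAt
  have hDp := hψ''.add
    ((hasDerivAt_sub_const_div_sinh ((m + 1 : ℤ) : ℝ) hA' hsinh).ofReal_comp.mul hψ')
  have hderiv : deriv (fun s => Dp A (m + 1) ψ s) r = _ := hDp.deriv
  unfold Dps
  rw [hderiv]
  unfold Dp
  push_cast
  ring

end
end

section
/- Formal adjointness of the nonlocal linearized operators with respect to the real inner product: let m ∈ ℤ, Q : (0,∞) → ℝ continuous and bounded, A : (0,∞) → ℝ continuous. For u define L_Q u := u' + ((A−m)/sinh r)u − (Q/sinh r)∫₀^r Re(Q(s)u(s)) sinh(s) ds, and L_Q* v := −v' − coth(r)v + ((A−m)/sinh r)v − Q(r)∫_r^∞ Re(Q(s)v(s)) ds. Then for all u, v ∈ C_c^∞((0,∞),ℂ): Re ∫₀^∞ (L_Q u)(r)·conj(v(r))·sinh(r) dr = Re ∫₀^∞ u(r)·conj((L_Q* v)(r))·sinh(r) dr.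 -/
/- Formal adjointness of the nonlocal linearized operators L_Q and L_Q* with
respect to the real inner product. -/

open MeasureTheory Set

noncomputable section

/-- The nonlocal linearized operator
`L_Q u = u' + ((A−m)/sinh r)u − (Q/sinh r)∫₀^r Re(Qu) sinh(s) ds`. -/
def LQ (m : ℤ) (Q A : ℝ → ℝ) (u : ℝ → ℂ) (r : ℝ) : ℂ :=
  deriv u r + (((A r - m) / Real.sinh r : ℝ) : ℂ) * u r
    - ((Q r / Real.sinh r : ℝ) : ℂ)
        * ((∫ s in Set.Ioc (0:ℝ) r, ((Q s : ℂ) * u s).re * Real.sinh s : ℝ) : ℂ)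

/-- Its formal adjoint
`L_Q* v = −v' − coth(r)v + ((A−m)/sinh r)v − Q∫_r^∞ Re(Qv) ds`. -/
def LQstar (m : ℤ) (Q A : ℝ → ℝ) (v : ℝ → ℂ) (r : ℝ) : ℂ :=
  -deriv v r - ((hcoth r : ℝ) : ℂ) * v r + (((A r - m) / Real.sinh r : ℝ) : ℂ) * v r
    - ((Q r : ℝ) : ℂ) * ((∫ s in Set.Ioi r, ((Q s : ℂ) * v s).re : ℝ) : ℂ)

/-- The integral of the derivative of `w + P * G` over a half-line vanishes when `w` is compactly
supported with `w 0 = 0`, `P` is the primitive of `p` and `G` is the tail integral of `q`. -/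
theorem integral_Ioi_deriv_add_primitive_mul_tail_eq_zero {p q w w' : ℝ → ℝ}
    (hp : Continuous p) (hps : HasCompactSupport p)
    (hq : Continuous q) (hqs : HasCompactSupport q)
    (hw : ∀ r, HasDerivAt w (w' r) r) (hws : HasCompactSupport w) (hw0 : w 0 = 0)
    (hint : IntegrableOn (fun r => w' r + (p r * ((∫ s in Ioi (0:ℝ), q s) - ∫ s in (0:ℝ)..r, q s)
      - (∫ s in (0:ℝ)..r, p s) * q r)) (Ioi 0)) :
    ∫ r in Ioi (0:ℝ), (w' r + (p r * ((∫ s in Ioi (0:ℝ), q s) - ∫ s in (0:ℝ)..r, q s)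
      - (∫ s in (0:ℝ)..r, p s) * q r)) = 0 := by
  have hpI : Integrable p := hp.integrable_of_hasCompactSupport hps
  have hqI : Integrable q := hq.integrable_of_hasCompactSupport hqs
  have hder : ∀ r, HasDerivAt
      (fun r => w r + (∫ s in (0:ℝ)..r, p s) * ((∫ s in Ioi (0:ℝ), q s) - ∫ s in (0:ℝ)..r, q s))
      (w' r + (p r * ((∫ s in Ioi (0:ℝ), q s) - ∫ s in (0:ℝ)..r, q s)
        - (∫ s in (0:ℝ)..r, p s) * q r)) r := by
    intro r
    have h := (hw r).add ((hp.integral_hasStrictDerivAt 0 r).hasDerivAt.mul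
      ((hq.integral_hasStrictDerivAt 0 r).hasDerivAt.const_sub (∫ s in Ioi (0:ℝ), q s)))
    refine h.congr_deriv ?_
    ring
  have hP := intervalIntegral_tendsto_integral_Ioi 0 hpI.integrableOn Filter.tendsto_id
  have hG := (intervalIntegral_tendsto_integral_Ioi 0 hqI.integrableOn
    Filter.tendsto_id).const_sub (∫ s in Ioi (0:ℝ), q s)
  have hwlim : Filter.Tendsto w Filter.atTop (nhds 0) :=
    hws.is_zero_at_infty.mono_left atTop_le_cocompact
  have hlim := hwlim.add (hP.mul hG)
  have h := integral_Ioi_of_hasDerivAt_of_tendsto (hder 0).continuousAt.continuousWithinAt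
    (fun r _ => hder r) hint hlim
  rw [h]
  simp [hw0]

/-- A tail integral is the total integral minus the initial one. -/
theorem setIntegral_Ioi_eq_sub_intervalIntegral {q : ℝ → ℝ} (hq : Integrable q) (r : ℝ) :
    ∫ s in Ioi r, q s = (∫ s in Ioi (0:ℝ), q s) - ∫ s in (0:ℝ)..r, q s := by
  rw [← intervalIntegral.integral_Ioi_sub_Ioi' hq.integrableOn hq.integrableOn]
  ring

/-- **Formal adjointness of `L_Q` and `L_Q*`** with respect to the real inner product
`(u,v) = Re ∫₀^∞ u v̄ sinh(r) dr`, for test functions `u, v ∈ C_c^∞((0,∞),ℂ)`. -/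
theorem LQ_formal_adjoint
    (m : ℤ) (Q A : ℝ → ℝ)
    (hQcont : Continuous Q) (hQbdd : ∃ M : ℝ, ∀ r, |Q r| ≤ M)
    (hAcont : Continuous A)
    (u v : ℝ → ℂ)
    (hu : ContDiff ℝ (⊤ : ℕ∞) u) (husupp : HasCompactSupport u)
    (husupp' : tsupport u ⊆ Set.Ioi 0)
    (hv : ContDiff ℝ (⊤ : ℕ∞) v) (hvsupp : HasCompactSupport v)
    (hvsupp' : tsupport v ⊆ Set.Ioi 0) :
    (∫ r in Set.Ioi (0:ℝ),
        LQ m Q A u r * (starRingEnd ℂ) (v r) * ((Real.sinh r : ℝ) : ℂ)).re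
      = (∫ r in Set.Ioi (0:ℝ),
        u r * (starRingEnd ℂ) (LQstar m Q A v r) * ((Real.sinh r : ℝ) : ℂ)).re := by
  have hrec : ∀ {f : ℝ → ℂ}, Continuous f → Continuous fun s => ((Q s : ℂ) * f s).re :=
    fun hf => Complex.continuous_re.comp ((Complex.continuous_ofReal.comp hQcont).mul hf)
  have hres : ∀ {f : ℝ → ℂ}, HasCompactSupport f →
      HasCompactSupport fun s => ((Q s : ℂ) * f s).re :=
    fun hf => (hf.mul_left (f := fun s => (Q s : ℂ))).comp_left (g := Complex.re) rfl
  set p : ℝ → ℝ := fun s => ((Q s : ℂ) * u s).re * Real.sinh s with hp_def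
  set q : ℝ → ℝ := fun s => ((Q s : ℂ) * v s).re with hq_def
  have hp : Continuous p := (hrec hu.continuous).mul Real.continuous_sinh
  have hps : HasCompactSupport p := (hres husupp).mul_right
  have hq : Continuous q := hrec hv.continuous
  have hqs : HasCompactSupport q := hres hvsupp
  have hqI : Integrable q := hq.integrable_of_hasCompactSupport hqs
  set P : ℝ → ℝ := fun r => ∫ s in (0:ℝ)..r, p s
  set G : ℝ → ℝ := fun r => (∫ s in Ioi (0:ℝ), q s) - ∫ s in (0:ℝ)..r, q s
  have hPc : Continuous P := intervalIntegral.continuous_primitive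
    (fun a b => hp.intervalIntegrable a b) 0
  have hGc : Continuous G := continuous_const.sub (intervalIntegral.continuous_primitive
    (fun a b => hq.intervalIntegrable a b) 0)
  have hu' : Continuous (deriv u) := hu.continuous_deriv (by simp)
  have hv' : Continuous (deriv v) := hv.continuous_deriv (by simp)
  have huc := hu.continuous
  have hvc := hv.continuous
  set f : ℝ → ℂ := fun r => (deriv u r * (Real.sinh r : ℂ) + ((A r - m : ℝ) : ℂ) * u r
    - (Q r : ℂ) * (P r : ℂ)) * (starRingEnd ℂ) (v r) with hf_def
  set g : ℝ → ℂ := fun r => u r * (starRingEnd ℂ) (-deriv v r * (Real.sinh r : ℂ)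
    - (Real.cosh r : ℂ) * v r + ((A r - m : ℝ) : ℂ) * v r
    - (Q r : ℂ) * (G r : ℂ) * (Real.sinh r : ℂ)) with hg_def
  have hsc : Continuous fun r : ℝ => (Real.sinh r : ℂ) :=
    Complex.continuous_ofReal.comp Real.continuous_sinh
  have hcc : Continuous fun r : ℝ => (Real.cosh r : ℂ) :=
    Complex.continuous_ofReal.comp Real.continuous_cosh
  have hfI : Integrable f := by
    refine Continuous.integrable_of_hasCompactSupport ?_ ?_
    · exact (by fun_prop : Continuous fun r => deriv u r * (Real.sinh r : ℂ)
        + ((A r - m : ℝ) : ℂ) * u r - (Q r : ℂ) * (P r : ℂ)).mul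
        (Complex.continuous_conj.comp hvc)
    · exact (hvsupp.comp_left (g := starRingEnd ℂ) (map_zero _)).mul_left
  have hgI : Integrable g := by
    refine Continuous.integrable_of_hasCompactSupport ?_ husupp.mul_right
    exact huc.mul (Complex.continuous_conj.comp (by fun_prop))
  have hL : ∫ r in Ioi (0:ℝ), LQ m Q A u r * (starRingEnd ℂ) (v r) * ((Real.sinh r : ℝ) : ℂ)
      = ∫ r in Ioi (0:ℝ), f r := by
    refine setIntegral_congr_fun measurableSet_Ioi fun r hr => ?_
    have hs : (Real.sinh r : ℂ) ≠ 0 := Complex.ofReal_ne_zero.2 (Real.sinh_pos_iff.2 hr).ne'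
    have hPr : ∫ s in Ioc (0:ℝ) r, p s = P r :=
      (intervalIntegral.integral_of_le (le_of_lt hr)).symm
    simp only [LQ, hf_def]
    rw [hPr, Complex.ofReal_div, Complex.ofReal_div]
    field_simp
  have hR : ∫ r in Ioi (0:ℝ), u r * (starRingEnd ℂ) (LQstar m Q A v r) * ((Real.sinh r : ℝ) : ℂ)
      = ∫ r in Ioi (0:ℝ), g r := by
    refine setIntegral_congr_fun measurableSet_Ioi fun r hr => ?_
    have hs : (Real.sinh r : ℂ) ≠ 0 := Complex.ofReal_ne_zero.2 (Real.sinh_pos_iff.2 hr).ne'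
    have hGr : ∫ s in Ioi r, q s = G r := setIntegral_Ioi_eq_sub_intervalIntegral hqI r
    simp only [LQstar, hcoth, hg_def]
    rw [hGr, mul_assoc, ← Complex.conj_ofReal (Real.sinh r), ← map_mul, Complex.conj_ofReal,
      Complex.ofReal_div, Complex.ofReal_div]
    congr 2
    field_simp
  have hw : ∀ r, HasDerivAt (fun r => (u r * (starRingEnd ℂ) (v r)).re * Real.sinh r)
      ((deriv u r * (starRingEnd ℂ) (v r) + u r * (starRingEnd ℂ) (deriv v r)).re * Real.sinh r
        + (u r * (starRingEnd ℂ) (v r)).re * Real.cosh r) r := by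
    intro r
    have hud := (hu.differentiable (by simp) r).hasDerivAt
    have hvd : HasDerivAt (fun r => (starRingEnd ℂ) (v r)) ((starRingEnd ℂ) (deriv v r)) r :=
      (hv.differentiable (by simp) r).hasDerivAt.star
    have huv : HasDerivAt (fun r => (u r * (starRingEnd ℂ) (v r)).re)
        (deriv u r * (starRingEnd ℂ) (v r) + u r * (starRingEnd ℂ) (deriv v r)).re r :=
      Complex.reCLM.hasFDerivAt.comp_hasDerivAt r (hud.mul hvd)
    exact huv.mul (Real.hasDerivAt_sinh r)
  have hws : HasCompactSupport fun r => (u r * (starRingEnd ℂ) (v r)).re * Real.sinh r :=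
    ((husupp.mul_right (f' := fun r => (starRingEnd ℂ) (v r))).comp_left
      (g := Complex.re) rfl).mul_right
  have hfg : (fun r => (f r - g r).re) = fun r =>
      ((deriv u r * (starRingEnd ℂ) (v r) + u r * (starRingEnd ℂ) (deriv v r)).re * Real.sinh r
        + (u r * (starRingEnd ℂ) (v r)).re * Real.cosh r) + (p r * G r - P r * q r) := by
    funext r
    simp only [hf_def, hg_def, hp_def, hq_def, Complex.sub_re, Complex.sub_im, Complex.add_re,
      Complex.add_im, Complex.mul_re, Complex.mul_im, Complex.conj_re, Complex.conj_im,
      Complex.neg_re, Complex.neg_im, Complex.ofReal_re, Complex.ofReal_im]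
    ring
  have hzero : ∫ r in Ioi (0:ℝ), (f r - g r).re = 0 := by
    have hI : IntegrableOn (fun r => (f r - g r).re) (Ioi 0) := (hfI.sub hgI).re.integrableOn
    rw [hfg] at hI ⊢
    exact integral_Ioi_deriv_add_primitive_mul_tail_eq_zero hp hps hq hqs hw hws (by simp) hI
  rw [hL, hR, ← sub_eq_zero, ← Complex.sub_re, ← integral_sub hfI.integrableOn hgI.integrableOn]
  refine Eq.trans ?_ hzero
  exact (integral_re (hfI.sub hgI).integrableOn).symm

end
end
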